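/- Let n ≥ 1 be an integer and let x, y be real numbers with x ≠ y. Then Σ_{k=0}^{n} E_k(x) E_{n-k}(y) − (4/(n+2)) · (B_{n+2}(x) − B_{n+2}(y)) / (x−y) = −2 Σ_{l=0}^{n+1} C(n+1, l) · (E_l(x−y) B_{n+1-l}(y) + E_l(y−x) B_{n+1-l}(x)) / (l+1). -/

import Mathlib

open Finset

/-- The `n`-th Bernoulli polynomial evaluated at a real `x`:
`B_n(x) = ∑_{k=0}^n (n choose k) B_k x^(n-k)`, where `B_k` is the `k`-th Bernoulli number
(with the convention `B_1 = -1/2`, i.e. generating function `z e^{xz}/(e^z - 1)`). -/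
noncomputable def bernoulliPoly (n : ℕ) (x : ℝ) : ℝ :=
  ∑ k ∈ Finset.range (n + 1), ((bernoulli k : ℚ) : ℝ) * (n.choose k : ℝ) * x ^ (n - k)

/-- The `n`-th harmonic number `H_n = ∑_{k=1}^n 1/k` as a real number. -/
noncomputable def harm (n : ℕ) : ℝ :=
  ∑ k ∈ Finset.range n, (1 : ℝ) / (k + 1)

/-- The `n`-th Euler polynomial evaluated at a real `x`, defined via the classical identity
`E_n(x) = (2/(n+1)) * (B_{n+1}(x) - 2^{n+1} B_{n+1}(x/2))`, which is equivalent to the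
generating-function definition `2 e^{xz}/(e^z + 1) = ∑ E_n(x) z^n/n!`. -/
noncomputable def eulerPoly (n : ℕ) (x : ℝ) : ℝ :=
  2 / (n + 1) * (bernoulliPoly (n + 1) x - 2 ^ (n + 1) * bernoulliPoly (n + 1) (x / 2))

lemma bp_aeval (n : ℕ) (x : ℝ) : bernoulliPoly n x = Polynomial.aeval x (Polynomial.bernoulli n) := by
  rw [Polynomial.bernoulli_def, map_sum, bernoulliPoly, ← Finset.sum_range_reflect]
  refine Finset.sum_congr rfl fun k hk => ?_
  have hk' : k ≤ n := by simpa [Nat.lt_succ_iff] using hk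
  have h1 : n + 1 - 1 - k = n - k := by omega
  have h2 : n - (n - k) = k := by omega
  rw [h1, h2, Polynomial.aeval_monomial, Nat.choose_symm hk']
  simp

lemma bp_zero (x : ℝ) : bernoulliPoly 0 x = 1 := by simp [bernoulliPoly]

lemma bp_deriv (n : ℕ) (x : ℝ) :
    HasDerivAt (bernoulliPoly (n+1)) (((n:ℝ)+1) * bernoulliPoly n x) x := by
  have h := (Polynomial.bernoulli (n+1)).hasDerivAt_aeval x
  rw [Polynomial.derivative_bernoulli_add_one] at h
  have e : bernoulliPoly (n+1) = fun x => Polynomial.aeval x (Polynomial.bernoulli (n+1)) :=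
    funext (bp_aeval _)
  rw [e, bp_aeval]
  simpa using h

lemma bp_add_one (n : ℕ) (x : ℝ) :
    bernoulliPoly (n+1) (x+1) = bernoulliPoly (n+1) x + ((n:ℝ)+1) * x^n := by
  have h := congrArg (Polynomial.aeval x) (Polynomial.bernoulli_comp_one_add_X (n+1))
  rw [Polynomial.aeval_comp] at h
  rw [bp_aeval, bp_aeval, add_comm x 1]
  simpa using h

/-- Appell-type uniqueness. -/
lemma appell_zero (f : ℕ → ℝ → ℝ) (c : ℕ → ℝ) (hc : ∀ n, c n ≠ 0)
    (hp : ∀ n x, f n (x+1) = f n x)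
    (h0 : ∀ x, HasDerivAt (f 0) 0 x)
    (hs : ∀ n x, HasDerivAt (f (n+1)) (c n * f n x) x) (n : ℕ) (x : ℝ) : f n x = 0 := by
  have key : ∀ n, (∀ x, HasDerivAt (f n) 0 x) → ∀ x, f n x = 0 := by
    intro n hn
    have hk : ∀ x, f n x = f n 0 := fun x =>
      is_const_of_deriv_eq_zero (fun x => (hn x).differentiableAt) (fun x => (hn x).deriv) x 0
    have hg : ∀ x, HasDerivAt (fun x => f (n+1) x - (c n * f n 0) * x) 0 x := by
      intro x
      have := (hs n x).fun_sub ((hasDerivAt_id x).const_mul (c n * f n 0))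
      rw [hk x] at this
      simpa using this
    have := is_const_of_deriv_eq_zero (fun x => (hg x).differentiableAt) (fun x => (hg x).deriv) 1 0
    have h1 := hp (n+1) 0
    rw [zero_add] at h1
    simp only [h1] at this
    have h2 : c n * f n 0 = 0 := by linarith
    have h3 := (mul_eq_zero.mp h2).resolve_left (hc n)
    intro x; rw [hk, h3]
  have hd : ∀ n, ∀ x, HasDerivAt (f n) 0 x := by
    intro n
    induction n with
    | zero => exact h0
    | succ n ih =>
      intro x
      have := hs n x
      rwa [key n ih x, mul_zero] at this
  exact key n (hd n) x

lemma bp_half_deriv (n : ℕ) (a x : ℝ) :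
    HasDerivAt (fun x => bernoulliPoly (n+1) (x/2+a))
      (((n:ℝ)+1)/2 * bernoulliPoly n (x/2+a)) x := by
  have h1 : HasDerivAt (fun x : ℝ => x/2+a) (1/2) x :=
    ((hasDerivAt_id x).div_const 2).add_const a
  have := (bp_deriv n (x/2+a)).comp x h1
  exact this.congr_deriv (by ring)

lemma bp_mul (n : ℕ) (x : ℝ) :
    2^n * (bernoulliPoly (n+1) (x/2) + bernoulliPoly (n+1) (x/2+1/2)) = bernoulliPoly (n+1) x := by
  have := appell_zero (fun n x => 2^n * (bernoulliPoly (n+1) (x/2+0) +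
    bernoulliPoly (n+1) (x/2+1/2)) - bernoulliPoly (n+1) x) (fun n => (n:ℝ)+2)
    (fun n => by positivity) ?_ ?_ ?_ n x
  · simp only [add_zero] at this; linarith
  · intro n x
    have e1 : (x+1)/2 + 0 = x/2+1/2 := by ring
    have e2 : (x+1)/2 + 1/2 = x/2+1 := by ring
    simp only [e1, e2, bp_add_one, add_zero]
    have : (2:ℝ)^n * (x/2)^n = x^n := by rw [← mul_pow]; congr 1; ring
    linear_combination ((n:ℝ)+1) * this
  · intro x
    have := (((bp_half_deriv 0 0 x).add (bp_half_deriv 0 (1/2) x)).const_mul (2^0)).sub (bp_deriv 0 x)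
    refine this.congr_deriv ?_
    simp only [bp_zero]; norm_num
  · intro n x
    have := (((bp_half_deriv (n+1) 0 x).add (bp_half_deriv (n+1) (1/2) x)).const_mul (2^(n+1))).sub
      (bp_deriv (n+1) x)
    refine this.congr_deriv ?_
    push_cast; ring

lemma ep_add_one (n : ℕ) (x : ℝ) : eulerPoly n (x+1) = 2 * x^n - eulerPoly n x := by
  have h := bp_mul n x
  have e : (x+1)/2 = x/2+1/2 := by ring
  have hn : (n:ℝ)+1 ≠ 0 := by positivity
  rw [eulerPoly, eulerPoly, bp_add_one, e, pow_succ]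
  generalize bernoulliPoly (n+1) (x/2+1/2) = A at *
  generalize bernoulliPoly (n+1) (x/2) = B at *
  field_simp
  linear_combination (-2) * h

lemma ep_deriv (n : ℕ) (x : ℝ) :
    HasDerivAt (eulerPoly (n+1)) (((n:ℝ)+1) * eulerPoly n x) x := by
  have := (((bp_deriv (n+1) x).sub ((bp_half_deriv (n+1) 0 x).const_mul (2^(n+1+1)))).const_mul
    (2/(((n+1:ℕ):ℝ)+1)))
  have e : eulerPoly (n+1) = fun x => 2 / (((n+1:ℕ):ℝ) + 1) * (bernoulliPoly (n + 1+1) x - 2 ^ (n + 1+1) * bernoulliPoly (n + 1+1) (x / 2+0)) := by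
    funext x; simp [eulerPoly]
  rw [e]
  refine this.congr_deriv ?_
  have hn : (n:ℝ)+1 ≠ 0 := by positivity
  have hn : (n:ℝ)+1+1 ≠ 0 := by positivity
  rw [eulerPoly, add_zero]; push_cast
  field_simp
  ring

lemma ep_zero (x : ℝ) : eulerPoly 0 x = 1 := by
  simp [eulerPoly, bernoulliPoly, Finset.sum_range_succ]; ring

lemma ep_add (n : ℕ) (s y : ℝ) : eulerPoly n (s+y) =
    ∑ l ∈ Finset.range (n+1), (n.choose l : ℝ) * eulerPoly l s * y^(n-l) := by
  induction n generalizing y with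
  | zero => simp [ep_zero]
  | succ n ih =>
    have hd : ∀ y, HasDerivAt (fun y => eulerPoly (n+1) (s+y) -
        ∑ l ∈ Finset.range (n+1+1), ((n+1).choose l : ℝ) * eulerPoly l s * y^(n+1-l)) 0 y := by
      intro y
      have h1 : HasDerivAt (fun y => eulerPoly (n+1) (s+y)) (((n:ℝ)+1) * eulerPoly n (s+y)) y := by
        have := (ep_deriv n (s+y)).comp y ((hasDerivAt_id y).const_add s)
        exact this.congr_deriv (by simp)
      have h2 := HasDerivAt.fun_sum (u := Finset.range (n+1+1)) (x := y) (fun l _ =>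
        (hasDerivAt_pow (n+1-l) y).const_mul (((n+1).choose l : ℝ) * eulerPoly l s))
      refine (h1.sub h2).congr_deriv ?_
      rw [ih, Finset.sum_range_succ _ (n+1), Finset.mul_sum, sub_eq_zero]
      simp only [Nat.sub_self, Nat.cast_zero, zero_mul, mul_zero, add_zero]
      refine Finset.sum_congr rfl fun l hl => ?_
      have hl' : l ≤ n := by simpa [Nat.lt_succ_iff] using hl
      have e : n + 1 - l - 1 = n - l := by omega
      have := Nat.choose_mul_succ_eq n l
      have h : (n.choose l : ℝ) * (n+1) = (n+1).choose l * ((n+1-l : ℕ) : ℝ) := by exact_mod_cast this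
      rw [e]
      linear_combination eulerPoly l s * y^(n-l) * h
    have := is_const_of_deriv_eq_zero (fun x => (hd x).differentiableAt) (fun x => (hd x).deriv) y 0
    simp only [add_zero] at this
    have h0 : ∑ l ∈ Finset.range (n+1+1), ((n+1).choose l : ℝ) * eulerPoly l s * (0:ℝ)^(n+1-l)
        = eulerPoly (n+1) s := by
      rw [Finset.sum_range_succ, Finset.sum_eq_zero]
      · simp
      · intro l hl
        have : n + 1 - l ≠ 0 := by have := Finset.mem_range.mp hl; omega
        simp [this]
    rw [h0] at this
    linarith

lemma sum_ep_pow (n : ℕ) (x y : ℝ) :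
    ∑ k ∈ Finset.range (n+1), eulerPoly k x * y^(n-k) =
    ∑ l ∈ Finset.range (n+1), ((n+1).choose (l+1) : ℝ) * eulerPoly l (x-y) * y^(n-l) := by
  have h : ∀ k ∈ Finset.range (n+1), eulerPoly k x * y^(n-k) =
      ∑ l ∈ Finset.range (n+1), (k.choose l : ℝ) * eulerPoly l (x-y) * y^(n-l) := by
    intro k hk
    have hk' : k ≤ n := by simpa [Nat.lt_succ_iff] using hk
    have := ep_add k (x-y) y
    rw [sub_add_cancel] at this
    rw [this, Finset.sum_mul]
    have hs : Finset.range (k+1) ⊆ Finset.range (n+1) := Finset.range_mono (by omega)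
    rw [← Finset.sum_subset hs]
    · refine Finset.sum_congr rfl fun l hl => ?_
      have hl' : l ≤ k := by simpa [Nat.lt_succ_iff] using hl
      have e : n - l = (k - l) + (n - k) := by omega
      rw [e, pow_add]; ring
    · intro l _ hl
      have : k < l := by simp at hl; omega
      simp [Nat.choose_eq_zero_of_lt this]
  rw [Finset.sum_congr rfl h, Finset.sum_comm]
  refine Finset.sum_congr rfl fun l hl => ?_
  rw [← Finset.sum_mul, ← Finset.sum_mul]
  congr 2
  have : ∀ n : ℕ, ∑ k ∈ Finset.range (n+1), k.choose l = (n+1).choose (l+1) := by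
    intro n
    induction n with
    | zero => cases l <;> simp [Nat.choose_eq_zero_of_lt]
    | succ n ih => rw [Finset.sum_range_succ, ih, Nat.choose_succ_succ (n+1) l, add_comm]
  exact_mod_cast this n

lemma geom_xy (n : ℕ) (x y : ℝ) (h : x - y ≠ 0) :
    ∑ k ∈ Finset.range (n+1), x^k * y^(n-k) = (x^(n+1) - y^(n+1)) / (x-y) := by
  rw [eq_div_iff h]
  have := (Commute.all x y).geom_sum₂_mul (n+1)
  simpa using this

lemma choose_real (n l : ℕ) :
    (n.choose l : ℝ) * (n+1) = (n+1).choose l * ((n+1-l : ℕ) : ℝ) := by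
  exact_mod_cast Nat.choose_mul_succ_eq n l

lemma choose_real' (n l : ℕ) :
    (n.choose l : ℝ) * (n+1) / ((l:ℝ)+1) = (n+1).choose (l+1) := by
  have hl : (l:ℝ)+1 ≠ 0 := by positivity
  rw [div_eq_iff hl, mul_comm]
  exact_mod_cast Nat.add_one_mul_choose_eq n l

/-- the convolution sum -/
noncomputable def SS (t : ℝ) (n : ℕ) (y : ℝ) : ℝ :=
  ∑ k ∈ Finset.range (n + 1), eulerPoly k (y+t) * eulerPoly (n - k) y

noncomputable def RR (t : ℝ) (n : ℕ) (y : ℝ) : ℝ :=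
  ∑ l ∈ Finset.range (n + 2), ((n + 1).choose l : ℝ) *
      (eulerPoly l t * bernoulliPoly (n + 1 - l) y +
        eulerPoly l (-t) * bernoulliPoly (n + 1 - l) (y+t)) / ((l : ℝ) + 1)

noncomputable def QQ (t : ℝ) (n : ℕ) (y : ℝ) : ℝ :=
  4 / ((n : ℝ) + 2) * ((bernoulliPoly (n + 2) (y+t) - bernoulliPoly (n + 2) y) / t)

lemma succ_sub_mem {n l : ℕ} (hl : l ∈ Finset.range (n+1)) : n + 1 - l = (n - l) + 1 := by
  have := Finset.mem_range.mp hl; omega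

lemma RR_eq (t : ℝ) (n : ℕ) (y : ℝ) : RR t n y =
    ∑ l ∈ Finset.range (n + 1), ((n + 1).choose l : ℝ) *
      (eulerPoly l t * bernoulliPoly (n - l + 1) y +
        eulerPoly l (-t) * bernoulliPoly (n - l + 1) (y+t)) / ((l : ℝ) + 1) +
    (eulerPoly (n+1) t + eulerPoly (n+1) (-t)) / ((n:ℝ)+1+1) := by
  rw [RR, Finset.sum_range_succ]
  congr 1
  · refine Finset.sum_congr rfl fun l hl => ?_
    rw [succ_sub_mem hl]
  · simp [bp_zero]

lemma SS_diff (t : ℝ) (ht : t ≠ 0) (n : ℕ) (y : ℝ) : SS t n (y+1) - SS t n y =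
    4 * (((y+t)^(n+1) - y^(n+1)) / t)
    - 2 * ∑ k ∈ Finset.range (n+1), eulerPoly k (y+t) * y^(n-k)
    - 2 * ∑ k ∈ Finset.range (n+1), eulerPoly k y * (y+t)^(n-k) := by
  have hg := geom_xy n (y+t) y (by simpa using ht)
  rw [add_sub_cancel_left] at hg
  have hr : ∑ k ∈ Finset.range (n+1), eulerPoly k y * (y+t)^(n-k) =
      ∑ k ∈ Finset.range (n+1), eulerPoly (n-k) y * (y+t)^k := by
    rw [← Finset.sum_range_reflect]
    refine Finset.sum_congr rfl fun l hl => ?_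
    have := Finset.mem_range.mp hl
    have e1 : n + 1 - 1 - l = n - l := by omega
    have e2 : n - (n - l) = l := by omega
    rw [e1, e2]
  rw [← hg, hr, SS, SS, ← Finset.sum_sub_distrib, Finset.mul_sum, Finset.mul_sum, Finset.mul_sum,
    ← Finset.sum_sub_distrib, ← Finset.sum_sub_distrib]
  refine Finset.sum_congr rfl fun l hl => ?_
  have e : y + 1 + t = (y + t) + 1 := by ring
  rw [e, ep_add_one, ep_add_one]
  ring

lemma RR_diff (t : ℝ) (n : ℕ) (y : ℝ) : RR t n (y+1) - RR t n y =
    (∑ k ∈ Finset.range (n+1), eulerPoly k (y+t) * y^(n-k))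
    + ∑ k ∈ Finset.range (n+1), eulerPoly k y * (y+t)^(n-k) := by
  have e0 : y + t - y = t := by ring
  have e1 : y - (y + t) = -t := by ring
  have e : y + 1 + t = (y + t) + 1 := by ring
  rw [sum_ep_pow, sum_ep_pow, e0, e1, RR_eq, RR_eq, add_sub_add_right_eq_sub,
    ← Finset.sum_sub_distrib, ← Finset.sum_add_distrib]
  refine Finset.sum_congr rfl fun l hl => ?_
  have h1 := choose_real n l
  rw [succ_sub_mem hl] at h1
  push_cast at h1
  rw [e, bp_add_one, bp_add_one, ← choose_real', h1]
  ring

lemma QQ_diff (t : ℝ) (n : ℕ) (y : ℝ) : QQ t n (y+1) - QQ t n y =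
    4 * (((y+t)^(n+1) - y^(n+1)) / t) := by
  have e : y + 1 + t = (y + t) + 1 := by ring
  have hn : (n:ℝ)+2 ≠ 0 := by positivity
  rw [QQ, QQ, e, bp_add_one, bp_add_one]
  push_cast
  field_simp
  ring

lemma shift_deriv {f : ℝ → ℝ} {c t y : ℝ} (h : HasDerivAt f c (y+t)) :
    HasDerivAt (fun y => f (y+t)) c y := by
  simpa using h.comp_add_const y t

lemma QQ_deriv (t : ℝ) (n : ℕ) (y : ℝ) : HasDerivAt (QQ t n)
    (4 * ((bernoulliPoly (n + 1) (y+t) - bernoulliPoly (n + 1) y) / t)) y := by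
  have := ((((shift_deriv (bp_deriv (n+1) (y+t))).sub (bp_deriv (n+1) y)).div_const t).const_mul
    (4 / ((n : ℝ) + 2)))
  refine this.congr_deriv ?_
  have hn : (n:ℝ)+2 ≠ 0 := by positivity
  push_cast
  field_simp
  ring

lemma RR_deriv (t : ℝ) (n : ℕ) (y : ℝ) : HasDerivAt (RR t n)
    (((n:ℝ)+1) * ∑ l ∈ Finset.range (n + 1), (n.choose l : ℝ) *
      (eulerPoly l t * bernoulliPoly (n - l) y +
        eulerPoly l (-t) * bernoulliPoly (n - l) (y+t)) / ((l : ℝ) + 1)) y := by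
  have h2 := (HasDerivAt.fun_sum (u := Finset.range (n+1)) (x := y) (fun l _ =>
    ((((bp_deriv (n-l) y).const_mul (eulerPoly l t)).add
      ((shift_deriv (bp_deriv (n-l) (y+t))).const_mul (eulerPoly l (-t)))).const_mul
        ((n+1).choose l : ℝ)).div_const ((l:ℝ)+1))).add_const
    ((eulerPoly (n+1) t + eulerPoly (n+1) (-t)) / ((n:ℝ)+1+1))
  rw [show RR t n = _ from funext (RR_eq t n)]
  refine h2.congr_deriv ?_
  rw [Finset.mul_sum]
  refine Finset.sum_congr rfl fun l hl => ?_
  have h1 := choose_real n l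
  rw [succ_sub_mem hl] at h1
  push_cast at h1
  linear_combination (-(eulerPoly l t * bernoulliPoly (n - l) y +
        eulerPoly l (-t) * bernoulliPoly (n - l) (y+t)) / ((l : ℝ) + 1)) * h1

lemma ep_deriv' (n : ℕ) (x : ℝ) :
    HasDerivAt (eulerPoly n) ((n:ℝ) * eulerPoly (n-1) x) x := by
  cases n with
  | zero =>
    have : eulerPoly 0 = fun _ => 1 := funext ep_zero
    rw [this]; simpa using hasDerivAt_const x (1:ℝ)
  | succ n => simpa using ep_deriv n x

lemma SS_deriv (t : ℝ) (n : ℕ) (y : ℝ) : HasDerivAt (SS t (n+1))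
    (((n:ℝ)+2) * SS t n y) y := by
  have h := HasDerivAt.fun_sum (u := Finset.range (n+1+1)) (x := y) (fun k _ =>
    (shift_deriv (ep_deriv' k (y+t))).mul (ep_deriv' (n+1-k) y))
  refine h.congr_deriv ?_
  rw [Finset.sum_add_distrib, Finset.sum_range_succ', Finset.sum_range_succ _ (n+1)]
  simp only [Nat.cast_zero, zero_mul, add_zero, Nat.sub_self, mul_zero]
  rw [← Finset.sum_add_distrib, SS, Finset.mul_sum]
  refine Finset.sum_congr rfl fun l hl => ?_
  have hl' := Finset.mem_range.mp hl
  have e1 : n + 1 - (l + 1) = n - l := by omega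
  rw [succ_sub_mem hl, e1, Nat.add_sub_cancel, Nat.add_sub_cancel]
  push_cast [Nat.cast_sub (show l ≤ n by omega)]
  ring

lemma main_zero (t : ℝ) (ht : t ≠ 0) (n : ℕ) (y : ℝ) : SS t n y - QQ t n y + 2 * RR t n y = 0 := by
  refine appell_zero (fun n y => SS t n y - QQ t n y + 2 * RR t n y) (fun n => (n:ℝ)+2)
    (fun n => by positivity) ?_ ?_ ?_ n y
  · intro n y
    have h1 := SS_diff t ht n y
    have h2 := RR_diff t n y
    have h3 := QQ_diff t n y
    show SS t n (y+1) - QQ t n (y+1) + 2 * RR t n (y+1) = SS t n y - QQ t n y + 2 * RR t n y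
    linear_combination h1 - h3 + 2 * h2
  · intro y
    have hS : HasDerivAt (SS t 0) 0 y := by
      have : SS t 0 = fun _ => 1 := by funext y; simp [SS, ep_zero]
      rw [this]; exact hasDerivAt_const _ _
    refine ((hS.sub (QQ_deriv t 0 y)).add ((RR_deriv t 0 y).const_mul 2)).congr_deriv ?_
    have hb : ∀ x, bernoulliPoly 1 x = x - 1/2 := by
      intro x; simp [bernoulliPoly, Finset.sum_range_succ]; ring
    simp [ep_zero, bp_zero, hb]
    field_simp
    norm_num
  · intro n y
    refine (((SS_deriv t n y).sub (QQ_deriv t (n+1) y)).add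
      ((RR_deriv t (n+1) y).const_mul 2)).congr_deriv ?_
    have hn : (n:ℝ)+2 ≠ 0 := by positivity
    have hq : 4 * ((bernoulliPoly (n + 1+1) (y+t) - bernoulliPoly (n + 1+1) y) / t) =
      ((n:ℝ)+2) * QQ t n y := by
      rw [QQ]; field_simp
    rw [hq]
    simp only [RR]
    push_cast
    ring

theorem stmt_9 (n : ℕ) (hn : 1 ≤ n) (x y : ℝ) (hxy : x ≠ y) :
    (∑ k ∈ Finset.range (n + 1), eulerPoly k x * eulerPoly (n - k) y) -
      4 / ((n : ℝ) + 2) * ((bernoulliPoly (n + 2) x - bernoulliPoly (n + 2) y) / (x - y)) =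
    -2 * ∑ l ∈ Finset.range (n + 2), ((n + 1).choose l : ℝ) *
      (eulerPoly l (x - y) * bernoulliPoly (n + 1 - l) y +
        eulerPoly l (y - x) * bernoulliPoly (n + 1 - l) x) / ((l : ℝ) + 1) := by
  have h := main_zero (x - y) (sub_ne_zero.mpr hxy) n y
  simp only [SS, QQ, RR, neg_sub, add_sub_cancel] at h
  linear_combination h
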